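/- For H = (H₀,H₁,H₂) and H̃ = (H̃₀,H̃₁,H̃₂) in (0,1)³ satisfying 0 < H₁,H̃₁ < 3/4, 0 < H₂,H̃₂ < 3/4, 3/2 < 2H₀+H₁+H₂ ≤ 7/4 and 3/2 < 2H̃₀+H̃₁+H̃₂ ≤ 7/4, and for any α ∈ (max(2−(2H₀+H₁+H₂), 2−(2H̃₀+H̃₁+H̃₂)), 1/2), the double integral ∬_{(ℝ²)²} K^H(η) K^{H̃}(η̃) / (1+|η−η̃|²)^{2α} dη dη̃ is finite, where K^H(η) := |η₁|^{1−2H₁} |η₂|^{1−2H₂} / (1+|η|^{4H₀}). -/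

import Mathlib

open MeasureTheory

noncomputable def Kfun (H : Fin 3 → ℝ) (η : EuclideanSpace ℝ (Fin 2)) : ℝ :=
  (|η 0| ^ (1 - 2 * H 1) * |η 1| ^ (1 - 2 * H 2)) / (1 + ‖η‖ ^ (4 * H 0))

/-- one-dimensional integrability -/
lemma aux_one_dim (b d : ℝ) (hb : -1 < b) (hd : 0 ≤ d) (hbd : b - d < -1) :
    Integrable (fun x : ℝ => |x| ^ b * (1 + |x|) ^ (-d)) := by
  have key := integrable_fun_norm_addHaar (E := ℝ) (F := ℝ) volume
    (f := fun x : ℝ => x ^ b * (1 + x) ^ (-d))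
  simp only [Real.norm_eq_abs] at key
  rw [key]
  simp only [Module.finrank_self, Nat.sub_self, pow_zero, one_smul]
  have hun : Set.Ioi (0:ℝ) = Set.Ioc 0 1 ∪ Set.Ioi 1 := by
    rw [Set.Ioc_union_Ioi_eq_Ioi zero_le_one]
  rw [hun, integrableOn_union]
  constructor
  · have h1 : IntegrableOn (fun x : ℝ => x ^ b) (Set.Ioc 0 1) := by
      have := intervalIntegral.intervalIntegrable_rpow' (a := 0) (b := 1) hb
      rwa [intervalIntegrable_iff_integrableOn_Ioc_of_le zero_le_one] at this
    refine h1.mono' (Measurable.aestronglyMeasurable (by fun_prop)) ?_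
    refine (ae_restrict_iff' measurableSet_Ioc).2 (Filter.Eventually.of_forall fun x hx => ?_)
    have hx0 : 0 < x := hx.1
    rw [Real.norm_of_nonneg (by positivity)]
    have : (1 + x) ^ (-d) ≤ 1 :=
      Real.rpow_le_one_of_one_le_of_nonpos (by linarith) (by linarith)
    exact mul_le_of_le_one_right (by positivity) this
  · have h1 : IntegrableOn (fun x : ℝ => x ^ (b - d)) (Set.Ioi 1) :=
      integrableOn_Ioi_rpow_of_lt hbd one_pos
    refine h1.mono' (Measurable.aestronglyMeasurable (by fun_prop)) ?_
    refine (ae_restrict_iff' measurableSet_Ioi).2 (Filter.Eventually.of_forall fun x hx => ?_)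
    have hx0 : 0 < x := lt_trans one_pos hx
    rw [Real.norm_of_nonneg (by positivity), sub_eq_add_neg, Real.rpow_add hx0]
    gcongr ?_ * ?_
    exact Real.rpow_le_rpow_of_nonpos hx0 (by linarith) (by linarith)

lemma aux_prod (f g : ℝ → ℝ) (hf : Integrable f) (hg : Integrable g) :
    Integrable (fun η : EuclideanSpace ℝ (Fin 2) => f (η 0) * g (η 1)) := by
  have h : Integrable (fun x : Fin 2 → ℝ => ∏ i, (![f, g] : Fin 2 → ℝ → ℝ) i (x i)) :=
    Integrable.fintype_prod (by intro i; fin_cases i <;> simpa)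
  have h2 := ((PiLp.volume_preserving_ofLp (Fin 2)).integrable_comp h.aestronglyMeasurable).2 h
  refine h2.congr (Filter.Eventually.of_forall fun x => ?_)
  simp [Fin.prod_univ_two]

lemma Kfun_nonneg (H : Fin 3 → ℝ) (η : EuclideanSpace ℝ (Fin 2)) : 0 ≤ Kfun H η := by
  unfold Kfun; positivity

lemma Kfun_measurable (H : Fin 3 → ℝ) : Measurable (Kfun H) := by
  unfold Kfun; fun_prop

lemma aux_denom (c θ N x y : ℝ) (hc : 0 < c) (h0 : 0 ≤ θ) (h1 : θ ≤ 1)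
    (hx : 0 ≤ x) (hy : 0 ≤ y) (hxN : x ≤ N) (hyN : y ≤ N) :
    (1 + x) ^ (c * θ) * (1 + y) ^ (c * (1 - θ)) ≤ 2 ^ c * (1 + N ^ c) := by
  have hN : 0 ≤ N := hx.trans hxN
  have e1 : (1 + x) ^ (c * θ) ≤ (1 + N) ^ (c * θ) :=
    Real.rpow_le_rpow (by linarith) (by linarith) (by positivity)
  have h1' : 0 ≤ 1 - θ := by linarith
  have e2 : (1 + y) ^ (c * (1 - θ)) ≤ (1 + N) ^ (c * (1 - θ)) :=
    Real.rpow_le_rpow (by linarith) (by linarith) (by positivity)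
  have e3 : (1 + N) ^ (c * θ) * (1 + N) ^ (c * (1 - θ)) = (1 + N) ^ c := by
    rw [← Real.rpow_add (by linarith)]; ring_nf
  have e4 : (1 + N) ^ c ≤ 2 ^ c * (1 + N ^ c) := by
    have hNc : 0 ≤ N ^ c := by positivity
    rcases le_total N 1 with h | h
    · have : (1 + N) ^ c ≤ 2 ^ c := Real.rpow_le_rpow (by linarith) (by linarith) hc.le
      have h2 : (0:ℝ) < 2 ^ c := by positivity
      nlinarith
    · have : (1 + N) ^ c ≤ (2 * N) ^ c := Real.rpow_le_rpow (by linarith) (by linarith) hc.le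
      rw [Real.mul_rpow (by norm_num) hN] at this
      have h2 : (0:ℝ) < 2 ^ c := by positivity
      nlinarith
  calc _ ≤ (1 + N) ^ (c * θ) * (1 + N) ^ (c * (1 - θ)) := by gcongr
    _ ≤ _ := by rw [e3]; exact e4

lemma Kfun_pow_integrable (H : Fin 3 → ℝ) (hH : ∀ i, H i ∈ Set.Ioo (0:ℝ) 1)
    (h1 : H 1 < 3/4) (h2 : H 2 < 3/4) (p : ℝ) (hp1 : 1 < p) (hp2 : p < 2)
    (hps : 1 < p * (2 * H 0 + H 1 + H 2 - 1)) :
    Integrable (fun η => Kfun H η ^ p) := by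
  have hp0 : 0 < p := by linarith
  have hH0 : 0 < H 0 := (hH 0).1
  obtain ⟨c, hc⟩ : ∃ c, c = 4 * H 0 := ⟨_, rfl⟩
  have hc0 : 0 < c := by rw [hc]; linarith
  have hb1 : -1 < (1 - 2 * H 1) * p := by nlinarith
  have hb2 : -1 < (1 - 2 * H 2) * p := by nlinarith
  have hcp : 0 < c * p := by positivity
  obtain ⟨θ, hθ1, hθ2⟩ : ∃ θ, ((1 - 2 * H 1) * p + 1) / (c * p) < θ ∧
      θ < 1 - ((1 - 2 * H 2) * p + 1) / (c * p) := by
    apply exists_between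
    rw [lt_sub_iff_add_lt, ← add_div, div_lt_one hcp, hc]
    nlinarith
  have hθ0 : 0 < θ := lt_trans (div_pos (by linarith) hcp) hθ1
  have hθ1' : 0 < 1 - θ := by
    have : 0 < ((1 - 2 * H 2) * p + 1) / (c * p) := div_pos (by linarith) hcp
    linarith
  rw [div_lt_iff₀ hcp] at hθ1
  have hθ2' : ((1 - 2 * H 2) * p + 1) / (c * p) < 1 - θ := by linarith
  rw [div_lt_iff₀ hcp] at hθ2'
  have I1 := aux_one_dim ((1 - 2 * H 1) * p) (c * θ * p) hb1 (by positivity) (by nlinarith)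
  have I2 := aux_one_dim ((1 - 2 * H 2) * p) (c * (1 - θ) * p) hb2 (by positivity) (by nlinarith)
  refine ((aux_prod _ _ I1 I2).const_mul ((2 ^ c) ^ p)).mono'
    (((Kfun_measurable H).pow_const p).aestronglyMeasurable)
    (Filter.Eventually.of_forall fun η => ?_)
  rw [Real.norm_of_nonneg (Real.rpow_nonneg (Kfun_nonneg _ _) _)]
  have hx : |η 0| ≤ ‖η‖ := by simpa using PiLp.norm_apply_le η 0
  have hy : |η 1| ≤ ‖η‖ := by simpa using PiLp.norm_apply_le η 1
  have hden := aux_denom c θ ‖η‖ |η 0| |η 1| hc0 hθ0.le (by linarith)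
    (abs_nonneg _) (abs_nonneg _) hx hy
  have hK : Kfun H η ≤ 2 ^ c * ((|η 0| ^ (1 - 2 * H 1) * (1 + |η 0|) ^ (-(c * θ))) *
      (|η 1| ^ (1 - 2 * H 2) * (1 + |η 1|) ^ (-(c * (1 - θ))))) := by
    unfold Kfun
    rw [← hc, Real.rpow_neg (by positivity), Real.rpow_neg (by positivity),
      div_le_iff₀ (by positivity)]
    have hA : 0 ≤ |η 0| ^ (1 - 2 * H 1) * |η 1| ^ (1 - 2 * H 2) := by positivity
    have hB : 0 < (1 + |η 0|) ^ (c * θ) * (1 + |η 1|) ^ (c * (1 - θ)) := by positivity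
    have : 1 ≤ (2 ^ c * (1 + ‖η‖ ^ c)) /
        ((1 + |η 0|) ^ (c * θ) * (1 + |η 1|) ^ (c * (1 - θ))) := (one_le_div hB).2 hden
    calc _ ≤ (|η 0| ^ (1 - 2 * H 1) * |η 1| ^ (1 - 2 * H 2)) * ((2 ^ c * (1 + ‖η‖ ^ c)) /
        ((1 + |η 0|) ^ (c * θ) * (1 + |η 1|) ^ (c * (1 - θ)))) := le_mul_of_one_le_right hA this
      _ = _ := by rw [div_eq_mul_inv, mul_inv]; ring
  refine (Real.rpow_le_rpow (Kfun_nonneg _ _) hK hp0.le).trans (le_of_eq ?_)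
  rw [Real.mul_rpow (by positivity) (by positivity), Real.mul_rpow (by positivity) (by positivity),
    Real.mul_rpow (by positivity) (by positivity), Real.mul_rpow (by positivity) (by positivity),
    ← Real.rpow_mul (abs_nonneg _), ← Real.rpow_mul (abs_nonneg _),
    ← Real.rpow_mul (by positivity), ← Real.rpow_mul (by positivity),
    ← Real.rpow_mul (by positivity), neg_mul, neg_mul]

lemma aux_young (q f g w : ℝ) (hq : 1/2 < q) (hq1 : q < 1) (hf : 0 ≤ f) (hg : 0 ≤ g)
    (hw : 0 ≤ w) :
    f * g * w ≤ (2 * q - 1) * (f ^ (1/q) * g ^ (1/q))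
      + (1 - q) * (f ^ (1/q) * w ^ (1/(2*(1-q))))
      + (1 - q) * (g ^ (1/q) * w ^ (1/(2*(1-q)))) := by
  have hq0 : 0 < q := by linarith
  have hv : 0 < 1 - q := by linarith
  obtain ⟨F, hF⟩ : ∃ F, F = f ^ (1/q) := ⟨_, rfl⟩
  obtain ⟨G, hG⟩ : ∃ G, G = g ^ (1/q) := ⟨_, rfl⟩
  obtain ⟨W, hW⟩ : ∃ W, W = w ^ (1/(2*(1-q))) := ⟨_, rfl⟩
  have hF0 : 0 ≤ F := by rw [hF]; positivity
  have hG0 : 0 ≤ G := by rw [hG]; positivity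
  have hW0 : 0 ≤ W := by rw [hW]; positivity
  have ef : f = F ^ q := by
    rw [hF, ← Real.rpow_mul hf, one_div_mul_cancel hq0.ne', Real.rpow_one]
  have eg : g = G ^ q := by
    rw [hG, ← Real.rpow_mul hg, one_div_mul_cancel hq0.ne', Real.rpow_one]
  have ew : w = W ^ (2*(1-q)) := by
    rw [hW, ← Real.rpow_mul hw, one_div_mul_cancel (by positivity), Real.rpow_one]
  rw [← hF, ← hG, ← hW]
  have key := Real.geom_mean_le_arith_mean3_weighted (w₁ := 2*q-1) (w₂ := 1-q) (w₃ := 1-q)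
    (p₁ := F*G) (p₂ := F*W) (p₃ := G*W) (by linarith) hv.le hv.le (by positivity) (by positivity)
    (by positivity) (by ring)
  refine le_trans (le_of_eq ?_) key
  have s1 : F ^ q = F ^ (2*q-1) * F ^ (1-q) := by
    rw [← Real.rpow_add_of_nonneg hF0 (by linarith) hv.le]; ring_nf
  have s2 : G ^ q = G ^ (2*q-1) * G ^ (1-q) := by
    rw [← Real.rpow_add_of_nonneg hG0 (by linarith) hv.le]; ring_nf
  have s3 : W ^ (2*(1-q)) = W ^ (1-q) * W ^ (1-q) := by
    rw [← Real.rpow_add_of_nonneg hW0 hv.le hv.le]; ring_nf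
  rw [ef, eg, ew, s1, s2, s3, Real.mul_rpow hF0 hG0, Real.mul_rpow hF0 hW0, Real.mul_rpow hG0 hW0]
  ring

theorem stmt18 (H Ht : Fin 3 → ℝ)
    (hH : ∀ i, H i ∈ Set.Ioo (0:ℝ) 1) (hHt : ∀ i, Ht i ∈ Set.Ioo (0:ℝ) 1)
    (h1 : H 1 < 3/4) (h1' : Ht 1 < 3/4) (h2 : H 2 < 3/4) (h2' : Ht 2 < 3/4)
    (hs : 3/2 < 2 * H 0 + H 1 + H 2) (hs' : 2 * H 0 + H 1 + H 2 ≤ 7/4)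
    (hts : 3/2 < 2 * Ht 0 + Ht 1 + Ht 2) (hts' : 2 * Ht 0 + Ht 1 + Ht 2 ≤ 7/4)
    (α : ℝ)
    (hα1 : max (2 - (2 * H 0 + H 1 + H 2)) (2 - (2 * Ht 0 + Ht 1 + Ht 2)) < α)
    (hα2 : α < 1/2) :
    Integrable (fun p : EuclideanSpace ℝ (Fin 2) × EuclideanSpace ℝ (Fin 2) =>
      Kfun H p.1 * Kfun Ht p.2 / (1 + ‖p.1 - p.2‖^2) ^ (2*α)) := by
  obtain ⟨ha, hb⟩ := max_lt_iff.1 hα1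
  obtain ⟨q, hq1, hq2⟩ : ∃ q, 1 - α < q ∧
      q < min (2 * H 0 + H 1 + H 2 - 1) (2 * Ht 0 + Ht 1 + Ht 2 - 1) := by
    apply exists_between
    rw [lt_min_iff]; constructor <;> linarith
  obtain ⟨hqa, hqb⟩ := lt_min_iff.1 hq2
  have hqh : 1/2 < q := by linarith
  have hqo : q < 1 := by linarith
  have hq0 : 0 < q := by linarith
  have hp1 : 1 < 1/q := by rw [lt_div_iff₀ hq0]; linarith
  have hp2 : 1/q < 2 := by rw [div_lt_iff₀ hq0]; linarith
  have IK := Kfun_pow_integrable H hH h1 h2 (1/q) hp1 hp2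
    (by rw [one_div_mul_eq_div, lt_div_iff₀ hq0]; linarith)
  have IKt := Kfun_pow_integrable Ht hHt h1' h2' (1/q) hp1 hp2
    (by rw [one_div_mul_eq_div, lt_div_iff₀ hq0]; linarith)
  have hv : 0 < 2 * (1 - q) := by linarith
  have IW : Integrable (fun z : EuclideanSpace ℝ (Fin 2) =>
      (((1 + ‖z‖^2) ^ (2*α))⁻¹) ^ (1/(2*(1-q)))) := by
    have := integrable_rpow_neg_one_add_norm_sq (E := EuclideanSpace ℝ (Fin 2)) (μ := volume)
      (r := 4 * α / (2 * (1 - q))) (by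
        simp only [finrank_euclideanSpace, Fintype.card_fin]
        rw [lt_div_iff₀ hv]; push_cast; linarith)
    refine this.congr (Filter.Eventually.of_forall fun z => ?_)
    have hz : 0 ≤ 1 + ‖z‖^2 := by positivity
    simp only
    rw [← Real.rpow_neg hz, ← Real.rpow_mul hz]
    congr 1
    ring
  have J1 := IK.mul_prod IKt
  have J2 := (IKt.convolution_integrand (ContinuousLinearMap.mul ℝ ℝ) IW)
  have J3 := (IK.convolution_integrand (ContinuousLinearMap.mul ℝ ℝ) IW).swap
  refine (((J1.const_mul (2*q-1)).add (J3.const_mul (1-q))).add (J2.const_mul (1-q))).mono' ?_ ?_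
  · apply Measurable.aestronglyMeasurable
    have := Kfun_measurable H
    have := Kfun_measurable Ht
    fun_prop
  · refine Filter.Eventually.of_forall fun z => ?_
    have n1 := Kfun_nonneg H z.1
    have n2 := Kfun_nonneg Ht z.2
    rw [Real.norm_of_nonneg (by positivity), div_eq_mul_inv]
    have := aux_young q _ _ (((1 + ‖z.1 - z.2‖^2) ^ (2*α))⁻¹) hqh hqo n1 n2 (by positivity)
    simpa [norm_sub_rev] using this
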